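/- arXiv:1512.08946 — 2 statements merged into one kernel-verified Lean document; each statement's English description precedes it below -/
import Mathlib

section
/- For a euclidean lattice E of rank n and any t > 0, Σ_{v∈E} ‖v‖² e^{-πt‖v‖²} ≤ (n/(2πt)) Σ_{v∈E} e^{-πt‖v‖²}. -/
open scoped Real

section GaussAux

variable {n : ℕ} (L : Submodule ℤ (EuclideanSpace ℝ (Fin n)))

/-- Shifted theta series. -/
noncomputable def thetaS (a : ℝ) (x : EuclideanSpace ℝ (Fin n)) : ℝ :=
  ∑' v : L, Real.exp (-a * ‖(v : EuclideanSpace ℝ (Fin n)) + x‖ ^ 2)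

lemma summable_gauss0 [DiscreteTopology L] (a : ℝ) (ha : 0 < a) :
    Summable fun v : L => Real.exp (-a * ‖(v : EuclideanSpace ℝ (Fin n))‖ ^ 2) := by
  set m := Module.finrank ℤ L + 1 with hm
  have h1 := ZLattice.summable_norm_pow_inv L (2 * m) (by omega)
  refine Summable.of_norm_bounded_eventually (h1.mul_left ((m.factorial : ℝ) / a ^ m)) ?_
  refine (Set.finite_singleton (0 : L)).subset ?_
  intro v hv
  by_contra hne
  apply hv
  show ‖Real.exp (-a * ‖(v : EuclideanSpace ℝ (Fin n))‖ ^ 2)‖ ≤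
    (m.factorial : ℝ) / a ^ m * ‖v‖⁻¹ ^ (2 * m)
  have hv0 : 0 < ‖(v : EuclideanSpace ℝ (Fin n))‖ := by
    rw [norm_pos_iff]
    intro h
    exact hne (by simpa using h)
  have h2 := Real.pow_div_factorial_le_exp (a * ‖(v : EuclideanSpace ℝ (Fin n))‖ ^ 2)
    (by positivity) m
  rw [Real.norm_of_nonneg (Real.exp_pos _).le, neg_mul, Real.exp_neg]
  rw [show (m.factorial : ℝ) / a ^ m * ‖v‖⁻¹ ^ (2 * m) =
    ((a * ‖(v : EuclideanSpace ℝ (Fin n))‖ ^ 2) ^ m / m.factorial)⁻¹ by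
      rw [← Submodule.norm_coe, mul_pow, ← pow_mul, inv_pow, inv_div]
      field_simp]
  exact inv_anti₀ (by positivity) h2

lemma gauss_shift_le (a : ℝ) (ha : 0 < a) (v x : EuclideanSpace ℝ (Fin n)) :
    Real.exp (-a * ‖v + x‖ ^ 2) ≤ Real.exp (a * ‖x‖ ^ 2) * Real.exp (-(a / 2) * ‖v‖ ^ 2) := by
  rw [← Real.exp_add]
  apply Real.exp_le_exp.mpr
  have h : ‖v‖ ≤ ‖v + x‖ + ‖x‖ := by
    simpa using norm_sub_le (v + x) x
  have h2 : ‖v‖ ^ 2 ≤ 2 * ‖v + x‖ ^ 2 + 2 * ‖x‖ ^ 2 := by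
    nlinarith [sq_nonneg (‖v + x‖ - ‖x‖), norm_nonneg v]
  nlinarith

lemma summable_gauss [DiscreteTopology L] (a : ℝ) (ha : 0 < a) (x : EuclideanSpace ℝ (Fin n)) :
    Summable fun v : L => Real.exp (-a * ‖(v : EuclideanSpace ℝ (Fin n)) + x‖ ^ 2) := by
  have ha2 : 0 < a / 2 := by positivity
  have h := (summable_gauss0 L (a / 2) ha2).mul_left (Real.exp (a * ‖x‖ ^ 2))
  refine Summable.of_nonneg_of_le (fun v => (Real.exp_pos _).le) (fun v => ?_) h
  have := gauss_shift_le a ha (v : EuclideanSpace ℝ (Fin n)) x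
  exact this

lemma thetaS_add (a : ℝ) (x : EuclideanSpace ℝ (Fin n)) (w : L) :
    thetaS L a (w + x) = thetaS L a x := by
  unfold thetaS
  rw [← (Equiv.addRight w).tsum_eq
    (fun v : L => Real.exp (-a * ‖(v : EuclideanSpace ℝ (Fin n)) + x‖ ^ 2))]
  simp [add_assoc]

lemma thetaS_bdd [DiscreteTopology L] [IsZLattice ℝ L] (a : ℝ) (ha : 0 < a) :
    ∃ C, ∀ x, thetaS L a x ≤ C := by
  have : Module.Finite ℤ L := ZLattice.module_finite ℝ L
  have : Module.Free ℤ L := ZLattice.module_free ℝ L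
  let b := (Module.Free.chooseBasis ℤ L).ofZLatticeBasis ℝ L
  have hb : Submodule.span ℤ (Set.range b) = L := Module.Basis.ofZLatticeBasis_span ℝ L _
  set R := ∑ i, ‖b i‖
  refine ⟨Real.exp (a * R ^ 2) *
    ∑' v : L, Real.exp (-(a / 2) * ‖(v : EuclideanSpace ℝ (Fin n))‖ ^ 2), fun x => ?_⟩
  have hmem : (ZSpan.floor b x : EuclideanSpace ℝ (Fin n)) ∈ L := by
    exact hb.le (ZSpan.floor b x).2
  have hx : x = ((⟨_, hmem⟩ : L) : EuclideanSpace ℝ (Fin n)) + ZSpan.fract b x := by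
    simp [ZSpan.fract]
  rw [hx, thetaS_add]
  have hR : ‖ZSpan.fract b x‖ ≤ R := ZSpan.norm_fract_le b x
  unfold thetaS
  rw [← tsum_mul_left]
  refine Summable.tsum_le_tsum (fun v => ?_) (summable_gauss L a ha _)
    ((summable_gauss0 L (a / 2) (by positivity)).mul_left _)
  have hg := gauss_shift_le a ha (v : EuclideanSpace ℝ (Fin n)) (ZSpan.fract b x)
  refine hg.trans ?_
  gcongr

/-- The subgroup `2L`. -/
noncomputable def twoL : Submodule ℤ L := LinearMap.range ((2 : ℤ) • (LinearMap.id : L →ₗ[ℤ] L))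

lemma mem_twoL (v : L) : v ∈ twoL L ↔ ∃ p : L, v = p + p := by
  unfold twoL
  constructor
  · rintro ⟨p, hp⟩
    exact ⟨p, by rw [← hp, LinearMap.smul_apply, LinearMap.id_apply, two_smul]⟩
  · rintro ⟨p, hp⟩
    exact ⟨p, by rw [hp, LinearMap.smul_apply, LinearMap.id_apply, two_smul]⟩

/-- reindexing map -/
noncomputable def reidx (z : (L ⧸ twoL L) × (L × L)) : L × L :=
  (z.1.out + z.2.1 + z.2.2, z.2.1 - z.2.2)

lemma out_spec (v : L) : ∃ p : L, v = (Submodule.Quotient.mk v : L ⧸ twoL L).out + (p + p) := by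
  have h : (Submodule.Quotient.mk ((Submodule.Quotient.mk v : L ⧸ twoL L).out) : L ⧸ twoL L)
      = Submodule.Quotient.mk v := Quotient.out_eq _
  have h2 := (Submodule.Quotient.eq (twoL L)).mp h.symm
  obtain ⟨p, hp⟩ := (mem_twoL L _).mp h2
  exact ⟨p, by rw [← hp]; abel⟩

lemma double_inj (p q : L) (h : p + p = q + q) : p = q := by
  have h2 : (p : EuclideanSpace ℝ (Fin n)) + p = q + q := congrArg Subtype.val h
  have h3 : (2 : ℝ) • (p : EuclideanSpace ℝ (Fin n)) = (2 : ℝ) • (q : EuclideanSpace ℝ (Fin n)) := by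
    rw [two_smul, two_smul, h2]
  exact Subtype.ext (smul_right_injective _ (by norm_num : (2 : ℝ) ≠ 0) h3)

lemma reidx_bij : Function.Bijective (reidx L) := by
  constructor
  · rintro ⟨c, p, q⟩ ⟨c', p', q'⟩ h
    simp only [reidx, Prod.mk.injEq] at h
    obtain ⟨h1, h2⟩ := h
    have hs : c.out + (p + p) = c'.out + (p' + p') := by
      calc c.out + (p + p) = (c.out + p + q) + (p - q) := by abel
        _ = (c'.out + p' + q') + (p' - q') := by rw [h1, h2]
        _ = _ := by abel
    have hc : c = c' := by
      have e1 : (Submodule.Quotient.mk c.out : L ⧸ twoL L) = c := Quotient.out_eq _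
      have e2 : (Submodule.Quotient.mk c'.out : L ⧸ twoL L) = c' := Quotient.out_eq _
      rw [← e1, ← e2, Submodule.Quotient.eq, mem_twoL]
      refine ⟨p' - p, ?_⟩
      have : c.out = c'.out + (p' + p') - (p + p) := by rw [← hs]; abel
      rw [this]; abel
    subst hc
    have hp : p = p' := double_inj L _ _ (add_left_cancel hs)
    subst hp
    have hq : q = q' := sub_right_injective h2
    rw [hq]
  · rintro ⟨v, w⟩
    obtain ⟨p, hp⟩ := out_spec L (v + w)
    refine ⟨(Submodule.Quotient.mk (v + w), p, p - w), ?_⟩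
    simp only [reidx, Prod.mk.injEq]
    constructor
    · have : v = (v + w) - w := by abel
      conv_rhs => rw [this, hp]
      abel
    · abel

lemma gauss_par (a : ℝ) (s p q x y : EuclideanSpace ℝ (Fin n)) :
    Real.exp (-a * ‖(s + p + q) + (x + y)‖ ^ 2) * Real.exp (-a * ‖(p - q) + (x - y)‖ ^ 2) =
    Real.exp (-(2 * a) * ‖p + (x + (1 / 2 : ℝ) • s)‖ ^ 2) *
      Real.exp (-(2 * a) * ‖q + (y + (1 / 2 : ℝ) • s)‖ ^ 2) := by
  rw [← Real.exp_add, ← Real.exp_add]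
  congr 1
  have h := parallelogram_law_with_norm ℝ (p + (x + (1 / 2 : ℝ) • s)) (q + (y + (1 / 2 : ℝ) • s))
  have e1 : p + (x + (1 / 2 : ℝ) • s) + (q + (y + (1 / 2 : ℝ) • s)) = (s + p + q) + (x + y) := by
    module
  have e2 : p + (x + (1 / 2 : ℝ) • s) - (q + (y + (1 / 2 : ℝ) • s)) = (p - q) + (x - y) := by
    module
  rw [e1, e2] at h
  linear_combination (-a) * h

lemma theta_mul [DiscreteTopology L] (a : ℝ) (ha : 0 < a) (x y : EuclideanSpace ℝ (Fin n)) :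
    HasSum (fun c : L ⧸ twoL L =>
      thetaS L (2 * a) (x + (1 / 2 : ℝ) • (c.out : EuclideanSpace ℝ (Fin n))) *
      thetaS L (2 * a) (y + (1 / 2 : ℝ) • (c.out : EuclideanSpace ℝ (Fin n))))
      (thetaS L a (x + y) * thetaS L a (x - y)) := by
  have key : ∀ (b : ℝ), 0 < b → ∀ x y, HasSum (fun z : L × L =>
      Real.exp (-b * ‖(z.1 : EuclideanSpace ℝ (Fin n)) + x‖ ^ 2) *
      Real.exp (-b * ‖(z.2 : EuclideanSpace ℝ (Fin n)) + y‖ ^ 2))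
      (thetaS L b x * thetaS L b y) := by
    intro b hb x y
    exact (summable_gauss L b hb x).hasSum.mul (summable_gauss L b hb y).hasSum
      ((summable_gauss L b hb x).mul_of_nonneg (summable_gauss L b hb y)
        (fun _ => (Real.exp_pos _).le) (fun _ => (Real.exp_pos _).le))
  have h := ((Equiv.ofBijective _ (reidx_bij L)).hasSum_iff).mpr (key a ha (x + y) (x - y))
  refine h.prod_fiberwise (fun c => ?_)
  convert! key (2 * a) (by positivity) (x + (1 / 2 : ℝ) • (c.out : EuclideanSpace ℝ (Fin n)))
    (y + (1 / 2 : ℝ) • (c.out : EuclideanSpace ℝ (Fin n))) using 2 with z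
  simp only [Function.comp, Equiv.ofBijective_apply, reidx]
  push_cast
  exact gauss_par a _ _ _ x y

lemma thetaS_le [DiscreteTopology L] [IsZLattice ℝ L] (a : ℝ) (ha : 0 < a)
    (x : EuclideanSpace ℝ (Fin n)) : thetaS L a x ≤ thetaS L a 0 := by
  have hpos : ∀ x, 0 ≤ thetaS L a x := fun x => tsum_nonneg fun _ => (Real.exp_pos _).le
  have hstep : ∀ x, 2 * (thetaS L a x) ^ 2 ≤
      thetaS L a (x + x) * thetaS L a 0 + thetaS L a 0 * thetaS L a 0 := by
    intro x
    have h1 := theta_mul L a ha x 0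
    have h2 := theta_mul L a ha x x
    have h3 := theta_mul L a ha 0 0
    have := hasSum_le (fun c => ?_) (h1.mul_left 2) (h2.add h3)
    · simpa [pow_two] using this
    · nlinarith [sq_nonneg (thetaS L (2 * a) (x + (1 / 2 : ℝ) • (c.out : EuclideanSpace ℝ (Fin n)))
        - thetaS L (2 * a) (0 + (1 / 2 : ℝ) • (c.out : EuclideanSpace ℝ (Fin n))))]
  obtain ⟨C, hC⟩ := thetaS_bdd L a ha
  have hB : BddAbove (Set.range (thetaS L a)) := ⟨C, by rintro _ ⟨x, rfl⟩; exact hC x⟩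
  set M := ⨆ x, thetaS L a x with hM
  have hle : ∀ x, thetaS L a x ≤ M := fun x => le_ciSup hB x
  set T := thetaS L a 0 with hT
  have hT0 : 0 ≤ T := hpos 0
  have hMT : T ≤ M := hle 0
  have hs : ∀ x, thetaS L a x ≤ √((M * T + T * T) / 2) := by
    intro x
    apply Real.le_sqrt_of_sq_le
    have := hstep x
    have h4 := mul_le_mul_of_nonneg_right (hle (x + x)) hT0
    linarith
  have hM2 : M ≤ √((M * T + T * T) / 2) := ciSup_le hs
  have hM3 : M ^ 2 ≤ (M * T + T * T) / 2 :=
    (Real.le_sqrt (hT0.trans hMT) (by have := hT0.trans hMT; positivity)).mp hM2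
  refine (hle x).trans ?_
  by_contra hlt
  push Not at hlt
  nlinarith

lemma cosh_ge (y : ℝ) : 1 + y ^ 2 / 2 ≤ Real.cosh y := by
  have h : Real.cosh y = 1 + 2 * Real.sinh (y / 2) ^ 2 := by
    have := Real.cosh_two_mul (y / 2)
    rw [mul_div_cancel₀ _ (by norm_num : (2 : ℝ) ≠ 0), Real.cosh_sq] at this
    linarith
  have h2 : (y / 2) ^ 2 ≤ Real.sinh (y / 2) ^ 2 := by
    apply sq_le_sq.mpr
    rw [Real.abs_sinh]
    exact Real.self_le_sinh_iff.mpr (abs_nonneg _)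
  rw [h]; linarith

lemma gauss_sym (a h : ℝ) (v e : EuclideanSpace ℝ (Fin n)) (he : ‖e‖ = 1) :
    2 * (Real.exp (-a * ‖v‖ ^ 2) + 2 * a ^ 2 * h ^ 2 *
      (inner ℝ v e ^ 2 * Real.exp (-a * ‖v‖ ^ 2))) ≤
    Real.exp (a * h ^ 2) * (Real.exp (-a * ‖v + h • e‖ ^ 2) +
      Real.exp (-a * ‖v + (-h) • e‖ ^ 2)) := by
  have h1 : ∀ h : ℝ, ‖v + h • e‖ ^ 2 = ‖v‖ ^ 2 + 2 * h * inner ℝ v e + h ^ 2 := by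
    intro h
    rw [norm_add_sq_real, inner_smul_right, norm_smul, he, mul_one, Real.norm_eq_abs, sq_abs]
    ring
  have h2 : Real.exp (a * h ^ 2) * (Real.exp (-a * ‖v + h • e‖ ^ 2) +
      Real.exp (-a * ‖v + (-h) • e‖ ^ 2)) =
      2 * (Real.exp (-a * ‖v‖ ^ 2) * Real.cosh (2 * a * h * inner ℝ v e)) := by
    rw [h1, h1, Real.cosh_eq]
    have e1 : Real.exp (-a * (‖v‖ ^ 2 + 2 * h * inner ℝ v e + h ^ 2)) =
        Real.exp (-a * ‖v‖ ^ 2) * Real.exp (-(2 * a * h * inner ℝ v e)) * Real.exp (-(a * h ^ 2)) := by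
      rw [← Real.exp_add, ← Real.exp_add]; congr 1; ring
    have e2 : Real.exp (-a * (‖v‖ ^ 2 + 2 * (-h) * inner ℝ v e + (-h) ^ 2)) =
        Real.exp (-a * ‖v‖ ^ 2) * Real.exp (2 * a * h * inner ℝ v e) * Real.exp (-(a * h ^ 2)) := by
      rw [← Real.exp_add, ← Real.exp_add]; congr 1; ring
    have e3 : Real.exp (a * h ^ 2) * Real.exp (-(a * h ^ 2)) = 1 := by
      rw [← Real.exp_add]; simp
    rw [e1, e2]
    linear_combination (Real.exp (-a * ‖v‖ ^ 2) * (Real.exp (-(2 * a * h * inner ℝ v e)) +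
      Real.exp (2 * a * h * inner ℝ v e))) * e3
  rw [h2]
  have := mul_le_mul_of_nonneg_left (cosh_ge (2 * a * h * inner ℝ v e))
    (Real.exp_pos (-a * ‖v‖ ^ 2)).le
  linarith

lemma summable_sq [DiscreteTopology L] (a : ℝ) (ha : 0 < a) :
    Summable fun v : L => ‖(v : EuclideanSpace ℝ (Fin n))‖ ^ 2 *
      Real.exp (-a * ‖(v : EuclideanSpace ℝ (Fin n))‖ ^ 2) := by
  refine Summable.of_nonneg_of_le (fun _ => by positivity) (fun v => ?_)
    ((summable_gauss0 L (a / 2) (by positivity)).mul_left (2 / a))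
  set r := ‖(v : EuclideanSpace ℝ (Fin n))‖ ^ 2
  have h1 : a / 2 * r ≤ Real.exp (a / 2 * r) := by
    linarith [Real.add_one_le_exp (a / 2 * r)]
  have h2 : Real.exp (-a * r) = Real.exp (-(a / 2) * r) * Real.exp (-(a / 2) * r) := by
    rw [← Real.exp_add]; congr 1; ring
  have h3 : Real.exp (a / 2 * r) * Real.exp (-(a / 2) * r) = 1 := by
    rw [← Real.exp_add]; simp
  have h4 : a / 2 * r * Real.exp (-(a / 2) * r) ≤ 1 := by
    rw [← h3]; gcongr
  have h5 : r * Real.exp (-(a / 2) * r) ≤ 2 / a := by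
    rw [le_div_iff₀ ha]; linarith
  rw [h2, ← mul_assoc]
  gcongr

lemma summable_inner [DiscreteTopology L] (a : ℝ) (ha : 0 < a) (e : EuclideanSpace ℝ (Fin n))
    (he : ‖e‖ = 1) :
    Summable fun v : L => inner ℝ (v : EuclideanSpace ℝ (Fin n)) e ^ 2 *
      Real.exp (-a * ‖(v : EuclideanSpace ℝ (Fin n))‖ ^ 2) := by
  refine Summable.of_nonneg_of_le (fun _ => by positivity) (fun v => ?_) (summable_sq L a ha)
  gcongr ?_ * _
  rw [← sq_abs]
  have := abs_real_inner_le_norm (v : EuclideanSpace ℝ (Fin n)) e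
  rw [he, mul_one] at this
  gcongr

lemma dir_bound [DiscreteTopology L] [IsZLattice ℝ L] (a : ℝ) (ha : 0 < a)
    (e : EuclideanSpace ℝ (Fin n)) (he : ‖e‖ = 1) :
    2 * a * (∑' v : L, inner ℝ (v : EuclideanSpace ℝ (Fin n)) e ^ 2 *
      Real.exp (-a * ‖(v : EuclideanSpace ℝ (Fin n))‖ ^ 2)) ≤ thetaS L a 0 := by
  set S := ∑' v : L, inner ℝ (v : EuclideanSpace ℝ (Fin n)) e ^ 2 *
      Real.exp (-a * ‖(v : EuclideanSpace ℝ (Fin n))‖ ^ 2) with hS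
  set T := thetaS L a 0 with hT
  have hT0 : 0 ≤ T := tsum_nonneg fun _ => (Real.exp_pos _).le
  have hTs : HasSum (fun v : L => Real.exp (-a * ‖(v : EuclideanSpace ℝ (Fin n))‖ ^ 2)) T := by
    have := (summable_gauss L a ha 0).hasSum
    simpa [hT, thetaS] using this
  have hmain : ∀ h : ℝ, T + 2 * a ^ 2 * h ^ 2 * S ≤ Real.exp (a * h ^ 2) * T := by
    intro h
    have h1 := hasSum_le (fun v : L => gauss_sym a h (v : EuclideanSpace ℝ (Fin n)) e he)
      ((hTs.add ((summable_inner L a ha e he).hasSum.mul_left (2 * a ^ 2 * h ^ 2))).mul_left 2)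
      (((summable_gauss L a ha (h • e)).hasSum.add
        (summable_gauss L a ha ((-h) • e)).hasSum).mul_left (Real.exp (a * h ^ 2)))
    have h2 := thetaS_le L a ha (h • e)
    have h3 := thetaS_le L a ha ((-h) • e)
    have h4 := mul_le_mul_of_nonneg_left (add_le_add h2 h3) (Real.exp_pos (a * h ^ 2)).le
    have h5 := h1.trans h4
    linarith
  have hu : ∀ u : ℝ, 0 < u → u ≤ 1 → 2 * a * S ≤ T + u * T := by
    intro u hu hu1
    have h1 := hmain (√(u / a))
    rw [Real.sq_sqrt (by positivity), mul_div_cancel₀ _ ha.ne'] at h1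
    have h2 := (abs_le.mp (Real.abs_exp_sub_one_sub_id_le
      (show |u| ≤ 1 by rwa [abs_of_pos hu]))).2
    have h3 : Real.exp u * T ≤ (1 + u + u ^ 2) * T := by gcongr; linarith
    have h4 : 2 * a ^ 2 * (u / a) * S = u * (2 * a * S) := by field_simp
    rw [h4] at h1
    refine le_of_mul_le_mul_left ?_ hu
    linarith
  refine le_of_forall_pos_le_add fun ε hε => ?_
  have hp : 0 < ε / (T + 1) := by positivity
  refine (hu (min 1 (ε / (T + 1))) (lt_min one_pos hp) (min_le_left _ _)).trans ?_
  have h6 : min 1 (ε / (T + 1)) * T ≤ ε / (T + 1) * (T + 1) := by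
    gcongr
    · exact min_le_right _ _
    · linarith
  rw [div_mul_cancel₀ _ (by positivity)] at h6
  linarith

end GaussAux

/-- For a euclidean lattice `E` of rank `n` and any `t > 0`,
`Σ_{v∈E} ‖v‖² e^{-πt‖v‖²} ≤ (n/(2πt)) Σ_{v∈E} e^{-πt‖v‖²}`. -/
theorem second_moment_gaussian_bound {n : ℕ}
    (L : Submodule ℤ (EuclideanSpace ℝ (Fin n)))
    [DiscreteTopology L] [IsZLattice ℝ L]
    (t : ℝ) (ht : 0 < t) :
    (∑' v : L, ‖(v : EuclideanSpace ℝ (Fin n))‖ ^ 2 *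
        Real.exp (-π * t * ‖(v : EuclideanSpace ℝ (Fin n))‖ ^ 2)) ≤
      ((n : ℝ) / (2 * π * t)) *
        ∑' v : L, Real.exp (-π * t * ‖(v : EuclideanSpace ℝ (Fin n))‖ ^ 2) := by
  have ha : 0 < π * t := by positivity
  have hr : -π * t = -(π * t) := by ring
  rw [hr, show 2 * π * t = 2 * (π * t) by ring]
  generalize π * t = a at ha
  let b := EuclideanSpace.basisFun (Fin n) ℝ
  have h1 : ∀ v : L, ‖(v : EuclideanSpace ℝ (Fin n))‖ ^ 2 *
        Real.exp (-a * ‖(v : EuclideanSpace ℝ (Fin n))‖ ^ 2) =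
      ∑ i, inner ℝ (v : EuclideanSpace ℝ (Fin n)) (b i) ^ 2 *
        Real.exp (-a * ‖(v : EuclideanSpace ℝ (Fin n))‖ ^ 2) := by
    intro v
    rw [← Finset.sum_mul, ← b.sum_sq_inner_left]
  simp_rw [h1]
  rw [Summable.tsum_finsetSum (fun i _ => summable_inner L a ha (b i) (b.norm_eq_one i))]
  have h2 := Finset.sum_le_sum (s := Finset.univ)
    (fun i _ => dir_bound L a ha (b i) (b.norm_eq_one i))
  rw [← Finset.mul_sum, Finset.sum_const, Finset.card_univ, Fintype.card_fin, nsmul_eq_mul] at h2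
  simp only [thetaS, add_zero] at h2
  rw [div_mul_eq_mul_div, le_div_iff₀ (by positivity)]
  linarith
end

section
/- Let E be a euclidean lattice of rank n, x ∈ E⊗R, r ≥ 0 and t ∈ (0,1]. Then Σ_{v∈E, ‖v−x‖≥r} e^{-π‖v−x‖²} ≤ t^{-n/2} e^{-π(1−t)r²} Σ_{v∈E} e^{-π‖v‖²}. -/
open scoped Real
open MeasureTheory

namespace Bana

variable {n : ℕ}

/-- Gaussian with values in `ENNReal`. -/
noncomputable def g (c : ℝ) (z : EuclideanSpace ℝ (Fin n)) : ENNReal :=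
  ENNReal.ofReal (Real.exp (-c * ‖z‖ ^ 2))

lemma g_meas (c : ℝ) : Measurable (g c : EuclideanSpace ℝ (Fin n) → ENNReal) := by
  unfold g; fun_prop

lemma g_neg (c : ℝ) (z : EuclideanSpace ℝ (Fin n)) : g c (-z) = g c z := by simp [g]

lemma lint_g {c : ℝ} (hc : 0 < c) :
    ∫⁻ z : EuclideanSpace ℝ (Fin n), g c z = ENNReal.ofReal ((π / c) ^ ((n : ℝ) / 2)) := by
  have h := GaussianFourier.integral_rexp_neg_mul_sq_norm (V := EuclideanSpace ℝ (Fin n)) hc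
  have hp : (0 : ℝ) < (π / c) ^ ((n : ℝ) / 2) := Real.rpow_pos_of_pos (by positivity) _
  simp only [finrank_euclideanSpace, Fintype.card_fin] at h
  have hi : Integrable (fun v : EuclideanSpace ℝ (Fin n) => Real.exp (-c * ‖v‖ ^ 2)) := by
    by_contra hni
    rw [integral_undef hni] at h
    exact hp.ne h
  rw [← h, ofReal_integral_eq_lintegral_ofReal hi (Filter.Eventually.of_forall fun _ => (Real.exp_pos _).le)]
  rfl

lemma conv_g {a b : ℝ} (ha : 0 < a) (hb : 0 < b) (y : EuclideanSpace ℝ (Fin n)) :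
    ∫⁻ z : EuclideanSpace ℝ (Fin n), g a (y - z) * g b z = g (a * b / (a + b)) y * ∫⁻ z : EuclideanSpace ℝ (Fin n), g (a + b) z := by
  have hab : a + b ≠ 0 := by positivity
  have key : ∀ z : EuclideanSpace ℝ (Fin n), g a (y - z) * g b z =
      g (a * b / (a + b)) y * g (a + b) (z - (a / (a + b)) • y) := by
    intro z
    unfold g
    rw [← ENNReal.ofReal_mul (Real.exp_pos _).le, ← ENNReal.ofReal_mul (Real.exp_pos _).le,
      ← Real.exp_add, ← Real.exp_add]
    congr 2
    rw [norm_sub_sq_real, norm_sub_sq_real, norm_smul, inner_smul_right, real_inner_comm y z,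
      mul_pow, Real.norm_eq_abs, sq_abs]
    field_simp
    ring
  simp_rw [key]
  have hm : Measurable fun z : EuclideanSpace ℝ (Fin n) => g (a + b) (z - (a / (a + b)) • y) :=
    (g_meas _).comp (measurable_id.sub_const _)
  rw [lintegral_const_mul _ hm,
    lintegral_sub_right_eq_self (fun z : EuclideanSpace ℝ (Fin n) => g (a + b) z)]

section
variable (L : Submodule ℤ (EuclideanSpace ℝ (Fin n))) [DiscreteTopology L] [IsZLattice ℝ L]

/-- Theta-like periodization. -/
noncomputable def F (c : ℝ) (x : EuclideanSpace ℝ (Fin n)) : ENNReal := ∑' v : L, g c ((v : EuclideanSpace ℝ (Fin n)) + x)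

lemma F_meas (c : ℝ) : Measurable (F L c) := by
  unfold F
  exact Measurable.tsum fun v => (g_meas c).comp (measurable_id.const_add _)

lemma F_per (c : ℝ) (w : L) (x : EuclideanSpace ℝ (Fin n)) : F L c ((w : EuclideanSpace ℝ (Fin n)) + x) = F L c x := by
  unfold F
  rw [← (Equiv.addRight w).tsum_eq (fun v : L => g c ((v : EuclideanSpace ℝ (Fin n)) + x))]
  simp [add_assoc]

lemma F_neg (c : ℝ) (x : EuclideanSpace ℝ (Fin n)) : F L c (-x) = F L c x := by
  unfold F
  rw [← (Equiv.neg L).tsum_eq (fun v : L => g c ((v : EuclideanSpace ℝ (Fin n)) + x))]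
  refine tsum_congr fun v => ?_
  rw [← g_neg]; simp [add_comm]

lemma two_mul_le (a b : ENNReal) : 2 * (a * b) ≤ a * a + b * b := by
  rcases eq_or_ne a ⊤ with rfl | ha
  · simp
  rcases eq_or_ne b ⊤ with rfl | hb
  · simp
  lift a to NNReal using ha
  lift b to NNReal using hb
  norm_cast
  have := two_mul_le_add_sq a b
  nlinarith

lemma unfold_int : ∃ D : Set (EuclideanSpace ℝ (Fin n)), ∀ (c : ℝ) (x y : EuclideanSpace ℝ (Fin n)),
    ∫⁻ z : EuclideanSpace ℝ (Fin n), F L c (x + z) * g c (y + z) = ∫⁻ z in D, F L c (x + z) * F L c (y + z) := by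
  have b := Module.Free.chooseBasis ℤ L
  have hD := ZLattice.isAddFundamentalDomain b (volume : Measure (EuclideanSpace ℝ (Fin n)))
  refine ⟨ZSpan.fundamentalDomain (b.ofZLatticeBasis ℝ), fun c x y => ?_⟩
  have : VAddInvariantMeasure L (EuclideanSpace ℝ (Fin n)) volume :=
    ⟨fun v s _ => measure_preimage_add volume (v : EuclideanSpace ℝ (Fin n)) s⟩
  rw [hD.lintegral_eq_tsum'']
  have : ∀ (v : L) (z : EuclideanSpace ℝ (Fin n)), F L c (x + (v +ᵥ z)) * g c (y + (v +ᵥ z)) =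
      F L c (x + z) * g c ((v : EuclideanSpace ℝ (Fin n)) + (y + z)) := by
    intro v z
    have e : (v +ᵥ z : EuclideanSpace ℝ (Fin n)) = (v : EuclideanSpace ℝ (Fin n)) + z := rfl
    rw [e, add_left_comm x, add_left_comm y, F_per]
  simp_rw [this]
  rw [← lintegral_tsum]
  · simp_rw [ENNReal.tsum_mul_left]; rfl
  · intro v
    exact (((F_meas L c).comp (measurable_id.const_add _)).mul
      ((g_meas c).comp ((measurable_id.const_add _).const_add _))).aemeasurable

lemma F_conv {a b : ℝ} (ha : 0 < a) (hb : 0 < b) (x : EuclideanSpace ℝ (Fin n)) :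
    ∫⁻ z : EuclideanSpace ℝ (Fin n), F L a (x - z) * g b z = F L (a * b / (a + b)) x * ∫⁻ z : EuclideanSpace ℝ (Fin n), g (a + b) z := by
  unfold F
  simp_rw [← ENNReal.tsum_mul_right]
  rw [lintegral_tsum]
  · refine tsum_congr fun v => ?_
    rw [← conv_g ha hb]
    simp_rw [add_sub_assoc]
  · intro v
    exact (((g_meas a).comp ((measurable_id.const_sub x).const_add _)).mul (g_meas b)).aemeasurable

lemma F_le (x : EuclideanSpace ℝ (Fin n)) : F L π x ≤ F L π 0 := by
  obtain ⟨D, hD⟩ := unfold_int L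
  have hpi := Real.pi_pos
  set q : ℝ := 2 * π with hq
  have hq0 : 0 < q := by positivity
  have hqq : q * q / (q + q) = π := by rw [hq]; field_simp; norm_num
  have hH : ∀ x : EuclideanSpace ℝ (Fin n), ∫⁻ z in D, F L q (x + z) * F L q (0 + z) =
      F L π x * ∫⁻ z : EuclideanSpace ℝ (Fin n), g (q + q) z := by
    intro x
    have := F_conv L hq0 hq0 x
    rw [hqq] at this
    rw [← hD, ← this, ← lintegral_neg_eq_self]
    refine lintegral_congr fun z => ?_
    simp [g_neg, sub_eq_add_neg]
  have hxx : ∫⁻ z in D, F L q (x + z) * F L q (x + z) =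
      ∫⁻ z in D, F L q (0 + z) * F L q (0 + z) := by
    rw [← hD, ← hD, lintegral_add_left_eq_self (fun z : EuclideanSpace ℝ (Fin n) => F L q z * g q z) x]
    simp
  have hC0 : ∫⁻ z : EuclideanSpace ℝ (Fin n), g (q + q) z ≠ 0 := by
    rw [lint_g (by positivity)]
    have : (0 : ℝ) < (π / (q + q)) ^ ((n : ℝ) / 2) := Real.rpow_pos_of_pos (by positivity) _
    simpa using this
  have hCt : ∫⁻ z : EuclideanSpace ℝ (Fin n), g (q + q) z ≠ ⊤ := by
    rw [lint_g (by positivity)]; exact ENNReal.ofReal_ne_top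
  have hm : ∀ x : EuclideanSpace ℝ (Fin n), Measurable fun z : EuclideanSpace ℝ (Fin n) => F L q (x + z) :=
    fun x => (F_meas L q).comp (measurable_id.const_add _)
  have main : 2 * (F L π x * ∫⁻ z : EuclideanSpace ℝ (Fin n), g (q + q) z) ≤ 2 * (F L π 0 * ∫⁻ z : EuclideanSpace ℝ (Fin n), g (q + q) z) := by
    have hm2 : Measurable fun z : EuclideanSpace ℝ (Fin n) => F L q (x + z) * F L q (0 + z) := (hm x).mul (hm 0)
    have hm3 : Measurable fun z : EuclideanSpace ℝ (Fin n) => F L q (x + z) * F L q (x + z) := (hm x).mul (hm x)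
    rw [← hH x, ← hH 0, ← lintegral_const_mul _ hm2]
    refine (lintegral_mono fun z => two_mul_le _ _).trans ?_
    rw [lintegral_add_left hm3, hxx, two_mul]
  rw [ENNReal.mul_le_mul_iff_right (by norm_num) (by norm_num),
    ENNReal.mul_le_mul_iff_left hC0 hCt] at main
  exact main

lemma F_le_t {t : ℝ} (ht0 : 0 < t) (ht1 : t ≤ 1) (x : EuclideanSpace ℝ (Fin n)) :
    F L (π * t) x ≤ ENNReal.ofReal (t ^ (-(n : ℝ) / 2)) * F L π 0 := by
  rcases ht1.eq_or_lt with rfl | ht1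
  · simpa using F_le L x
  have hpi := Real.pi_pos
  have h1 : 0 < 1 - t := by linarith
  set s : ℝ := π * t / (1 - t) with hs
  have hs0 : 0 < s := by positivity
  have e1 : π * s / (π + s) = π * t := by rw [hs]; field_simp; ring
  have e2 : π + s = π / (1 - t) := by rw [hs]; field_simp; ring
  have h := F_conv L hpi hs0 x
  rw [e1, lint_g (by positivity)] at h
  have h2 : ∫⁻ z : EuclideanSpace ℝ (Fin n), F L π (x - z) * g s z ≤ F L π 0 * ENNReal.ofReal ((π / s) ^ ((n : ℝ) / 2)) := by
    rw [← lint_g hs0, ← lintegral_const_mul _ (g_meas s)]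
    exact lintegral_mono fun z => mul_le_mul_left (F_le L _) _
  rw [h] at h2
  have hA : (0 : ℝ) < (π / (π + s)) ^ ((n : ℝ) / 2) := Real.rpow_pos_of_pos (by positivity) _
  have e3 : (π / s) ^ ((n : ℝ) / 2) = t ^ (-(n : ℝ) / 2) * (π / (π + s)) ^ ((n : ℝ) / 2) := by
    rw [neg_div, Real.rpow_neg ht0.le, ← Real.inv_rpow ht0.le, ← Real.mul_rpow (by positivity) (by positivity), e2, hs]
    congr 1
    field_simp
  rw [e3, ENNReal.ofReal_mul (Real.rpow_nonneg ht0.le _), ← mul_assoc,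
    ENNReal.mul_le_mul_iff_left (by simpa using hA) ENNReal.ofReal_ne_top, mul_comm (F L π 0)] at h2
  exact h2

lemma summ : Summable fun v : L => Real.exp (-π * ‖(v : EuclideanSpace ℝ (Fin n))‖ ^ 2) := by
  set k := Module.finrank ℤ L + 1 with hk
  have h := (ZLattice.summable_norm_pow_inv L (2 * k) (by omega)).mul_left ((k.factorial : ℝ) / π ^ k)
  refine Summable.of_norm_bounded_eventually h ?_
  have hf : {v : L | v ≠ 0}ᶜ.Finite := by
    convert Set.finite_singleton (0 : L) using 1
    ext; simp
  filter_upwards [show {v : L | v ≠ 0} ∈ Filter.cofinite from hf] with v hv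
  have hv0 : 0 < ‖v‖ := norm_pos_iff.mpr hv
  have hpi := Real.pi_pos
  have hb := Real.pow_div_factorial_le_exp (π * ‖v‖ ^ 2) (by positivity) k
  have hfac : (0 : ℝ) < k.factorial := by positivity
  rw [Real.norm_eq_abs, abs_of_pos (Real.exp_pos _)]
  change Real.exp (-π * ‖v‖ ^ 2) ≤ _
  rw [neg_mul, Real.exp_neg]
  calc _ ≤ ((π * ‖v‖ ^ 2) ^ k / k.factorial)⁻¹ := inv_anti₀ (by positivity) hb
    _ = _ := by rw [mul_pow, ← pow_mul, inv_pow]; field_simp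

end
end Bana

/-- Let `E` be a euclidean lattice of rank `n`, `x ∈ E⊗ℝ`, `r ≥ 0` and
`t ∈ (0,1]`. Then `Σ_{v∈E, ‖v−x‖≥r} e^{-π‖v−x‖²} ≤ t^{-n/2} e^{-π(1−t)r²} Σ_{v∈E} e^{-π‖v‖²}`. -/
theorem banaszczyk_tail_bound {n : ℕ}
    (L : Submodule ℤ (EuclideanSpace ℝ (Fin n)))
    [DiscreteTopology L] [IsZLattice ℝ L]
    (x : EuclideanSpace ℝ (Fin n)) (r t : ℝ) (hr : 0 ≤ r) (ht0 : 0 < t) (ht1 : t ≤ 1) :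
    (∑' v : L, (if r ≤ ‖(v : EuclideanSpace ℝ (Fin n)) - x‖ then
        Real.exp (-π * ‖(v : EuclideanSpace ℝ (Fin n)) - x‖ ^ 2) else 0)) ≤
      t ^ (-(n : ℝ) / 2) * Real.exp (-π * (1 - t) * r ^ 2) *
        ∑' v : L, Real.exp (-π * ‖(v : EuclideanSpace ℝ (Fin n))‖ ^ 2) := by
  have hpi := Real.pi_pos
  have hs := Bana.summ L
  have hR : (Bana.F L π 0) = ENNReal.ofReal
      (∑' v : L, Real.exp (-π * ‖(v : EuclideanSpace ℝ (Fin n))‖ ^ 2)) := by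
    rw [ENNReal.ofReal_tsum_of_nonneg (fun _ => (Real.exp_pos _).le) hs]
    simp [Bana.F, Bana.g]
  have ht : 0 ≤ t ^ (-(n : ℝ) / 2) := Real.rpow_nonneg ht0.le _
  have hS : 0 ≤ ∑' v : L, Real.exp (-π * ‖(v : EuclideanSpace ℝ (Fin n))‖ ^ 2) :=
    tsum_nonneg fun _ => (Real.exp_pos _).le
  have hK : 0 ≤ t ^ (-(n : ℝ) / 2) * Real.exp (-π * (1 - t) * r ^ 2) *
        ∑' v : L, Real.exp (-π * ‖(v : EuclideanSpace ℝ (Fin n))‖ ^ 2) := by positivity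
  have hnn : ∀ v : L, 0 ≤ (if r ≤ ‖(v : EuclideanSpace ℝ (Fin n)) - x‖ then
        Real.exp (-π * ‖(v : EuclideanSpace ℝ (Fin n)) - x‖ ^ 2) else 0) := by
    intro v; split_ifs <;> positivity
  refine Real.tsum_le_of_sum_le hnn fun u => ?_
  rw [← ENNReal.ofReal_le_ofReal_iff hK, ENNReal.ofReal_sum_of_nonneg fun v _ => hnn v]
  refine (ENNReal.sum_le_tsum u).trans ?_
  have hpt : ∀ v : L, ENNReal.ofReal (if r ≤ ‖(v : EuclideanSpace ℝ (Fin n)) - x‖ then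
        Real.exp (-π * ‖(v : EuclideanSpace ℝ (Fin n)) - x‖ ^ 2) else 0) ≤
      ENNReal.ofReal (Real.exp (-π * (1 - t) * r ^ 2)) * Bana.g (π * t) ((v : EuclideanSpace ℝ (Fin n)) + -x) := by
    intro v
    unfold Bana.g
    rw [← ENNReal.ofReal_mul (Real.exp_pos _).le, ← sub_eq_add_neg]
    apply ENNReal.ofReal_le_ofReal
    split_ifs with h
    · rw [← Real.exp_add]
      apply Real.exp_le_exp.mpr
      have h2 : r ^ 2 ≤ ‖(v : EuclideanSpace ℝ (Fin n)) - x‖ ^ 2 := by gcongr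
      have h3 : 0 ≤ π * (1 - t) := mul_nonneg hpi.le (by linarith)
      nlinarith [mul_le_mul_of_nonneg_left h2 h3]
    · positivity
  refine (ENNReal.tsum_le_tsum hpt).trans ?_
  rw [ENNReal.tsum_mul_left, ENNReal.ofReal_mul (by positivity), ENNReal.ofReal_mul ht, ← hR,
    mul_comm (ENNReal.ofReal (t ^ _)), mul_assoc (ENNReal.ofReal _)]
  exact mul_le_mul_right (Bana.F_le_t L ht0 ht1 (-x)) _
end
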